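/- arXiv:1901.09580 — 2 statements merged into one kernel-verified Lean document; each statement's English description precedes it below -/
import Mathlib

section
/- Let (δ,σ) be a modular pair on the Hopf algebra H, let D_H be a left H-category and let T be a σ-trace on D_H. Then T is δ-invariant if and only if T_X((h·g)∘f) = T_X(g∘(S_δ(h)·f)) for all h ∈ H and all morphisms f : X → Y and g : Y → X in D_H. -/
open TensorProduct

noncomputable section

namespace HopfCyclicStmt

variable (k H : Type) [Field k] [CharZero k] [Ring H] [HopfAlgebra k H]

/-- A left `H`-category: a small `k`-linear category whose Hom-spaces are left `H`-modules,
with `h • id_X = ε(h) • id_X` and `h • (g ∘ f) = (h₁ • g) ∘ (h₂ • f)` (the latter stated by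
quantifying over all finite representations of `comul h` as a sum of pure tensors). -/
structure HCategory (k H : Type) [Field k] [Ring H] [HopfAlgebra k H] where
  Obj : Type
  Hom : Obj → Obj → Type
  [homAddCommGroup : ∀ X Y, AddCommGroup (Hom X Y)]
  [homModule : ∀ X Y, Module k (Hom X Y)]
  id : (X : Obj) → Hom X X
  comp : {X Y Z : Obj} → Hom Y Z →ₗ[k] Hom X Y →ₗ[k] Hom X Z
  id_comp : ∀ {X Y : Obj} (f : Hom X Y), comp (id Y) f = f
  comp_id : ∀ {X Y : Obj} (f : Hom X Y), comp f (id X) = f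
  comp_assoc : ∀ {W X Y Z : Obj} (h : Hom Y Z) (g : Hom X Y) (f : Hom W X),
      comp h (comp g f) = comp (comp h g) f
  act : (X Y : Obj) → H →ₗ[k] Hom X Y →ₗ[k] Hom X Y
  act_one : ∀ {X Y : Obj} (f : Hom X Y), act X Y 1 f = f
  act_mul : ∀ {X Y : Obj} (a b : H) (f : Hom X Y),
      act X Y (a * b) f = act X Y a (act X Y b f)
  act_id : ∀ (X : Obj) (h : H), act X X h (id X) = Coalgebra.counit (R := k) h • id X
  act_comp : ∀ {X Y Z : Obj} (h : H) (g : Hom Y Z) (f : Hom X Y)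
      {ι : Type} (s : Finset ι) (a b : ι → H),
      Coalgebra.comul (R := k) h = ∑ i ∈ s, a i ⊗ₜ[k] b i →
      act X Z h (comp g f) = ∑ i ∈ s, comp (act Y Z (a i) g) (act X Y (b i) f)

attribute [instance] HCategory.homAddCommGroup HCategory.homModule

variable {k H}

/-- `σ` is a group-like element. -/
def IsGroupLike (σ : H) : Prop :=
  Coalgebra.comul (R := k) σ = σ ⊗ₜ[k] σ ∧ Coalgebra.counit (R := k) σ = 1

/-- The `δ`-twisted antipode `S_δ(h) = δ(h₁) S(h₂)`. -/
def twistedAntipode (δ : H →ₐ[k] k) : H →ₗ[k] H :=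
  (TensorProduct.lid k H).toLinearMap
    ∘ₗ TensorProduct.map δ.toLinearMap (HopfAlgebra.antipode (R := k))
    ∘ₗ Coalgebra.comul (R := k)

/-- A `σ`-trace on a left `H`-category: `T_X(g ∘ f) = T_Y(f ∘ (σ • g))`. -/
def IsSigmaTrace (C : HCategory k H) (σ : H)
    (T : ∀ X : C.Obj, C.Hom X X →ₗ[k] k) : Prop :=
  ∀ (X Y : C.Obj) (f : C.Hom X Y) (g : C.Hom Y X),
    T X (C.comp g f) = T Y (C.comp f (C.act Y X σ g))

/-- `δ`-invariance of a trace: `T_X(h • f) = δ(h) T_X(f)`. -/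
def IsDeltaInvariant (C : HCategory k H) (δ : H →ₐ[k] k)
    (T : ∀ X : C.Obj, C.Hom X X →ₗ[k] k) : Prop :=
  ∀ (X : C.Obj) (h : H) (f : C.Hom X X), T X (C.act X X h f) = δ h * T X f

theorem twistedAntipode_repr (δ : H →ₐ[k] k) (h : H) {ι : Type} (r : Coalgebra.Repr k h ι) :
    twistedAntipode δ h
      = ∑ i ∈ r.index, δ (r.left i) • HopfAlgebra.antipode k (r.right i) := by
  simp [twistedAntipode, ← r.eq, map_sum]

theorem sum_counit_smul_left (h : H) {ι : Type} (r : Coalgebra.Repr k h ι) :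
    ∑ i ∈ r.index, Coalgebra.counit (R := k) (r.right i) • r.left i = h := by
  simpa only [map_sum, TensorProduct.rid_tmul, one_smul] using
    congrArg (TensorProduct.rid k H) (Coalgebra.sum_tmul_counit_eq (R := k) r)

/-- The map `a ⊗ (b ⊗ c) ↦ T((a • g) ∘ ((b S(c)) • f))`. -/
def auxMap (C : HCategory k H) (T : ∀ X : C.Obj, C.Hom X X →ₗ[k] k) {X Y : C.Obj}
    (f : C.Hom X Y) (g : C.Hom Y X) : H ⊗[k] (H ⊗[k] H) →ₗ[k] k :=
  TensorProduct.lift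
    (((C.comp.compr₂ (T X)).compl₁₂ ((C.act Y X).flip g)
      ((C.act X Y).flip f ∘ₗ LinearMap.mul' k H ∘ₗ
        (HopfAlgebra.antipode k).lTensor H)))

theorem auxMap_tmul (C : HCategory k H) (T : ∀ X : C.Obj, C.Hom X X →ₗ[k] k) {X Y : C.Obj}
    (f : C.Hom X Y) (g : C.Hom Y X) (a b c : H) :
    auxMap C T f g (a ⊗ₜ (b ⊗ₜ c))
      = T X (C.comp (C.act Y X a g) (C.act X Y (b * HopfAlgebra.antipode k c) f)) := by
  simp [auxMap]

/-- Let `(δ,σ)` be a modular pair on `H`, `C` a left `H`-category and `T` a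
`σ`-trace on `C`.  Then `T` is `δ`-invariant iff
`T_X((h•g) ∘ f) = T_X(g ∘ (S_δ(h)•f))` for all `h : H`, `f : X → Y`, `g : Y → X`. -/
theorem statement0
    (hbij : Function.Bijective (HopfAlgebra.antipode (R := k) (A := H)))
    (δ : H →ₐ[k] k) (σ : H) (hσ : IsGroupLike (k := k) σ) (hδσ : δ σ = 1)
    (C : HCategory k H) (T : ∀ X : C.Obj, C.Hom X X →ₗ[k] k)
    (hT : IsSigmaTrace C σ T) :
    IsDeltaInvariant C δ T ↔
      ∀ (X Y : C.Obj) (h : H) (f : C.Hom X Y) (g : C.Hom Y X),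
        T X (C.comp (C.act Y X h g) f)
          = T X (C.comp g (C.act X Y (twistedAntipode δ h) f)) := by
  constructor
  · intro hI X Y h f g
    let r := Coalgebra.Repr.arbitrary k h
    let r₁ := fun i => Coalgebra.Repr.arbitrary k (r.left i)
    let r₂ := fun i => Coalgebra.Repr.arbitrary k (r.right i)
    have key := congrArg (auxMap C T f g) (Coalgebra.sum_tmul_tmul_eq r r₁ r₂)
    simp only [map_sum, auxMap_tmul] at key
    have e1 : T X (C.comp g (C.act X Y (twistedAntipode δ h) f))
        = ∑ i ∈ r.index, ∑ j ∈ (r₁ i).index, T X (C.comp (C.act Y X ((r₁ i).left j) g)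
          (C.act X Y ((r₁ i).right j * HopfAlgebra.antipode k (r.right i)) f)) := by
      rw [twistedAntipode_repr δ h r]
      simp only [map_sum, LinearMap.sum_apply, map_smul, LinearMap.smul_apply, smul_eq_mul]
      refine Finset.sum_congr rfl fun i _ => ?_
      rw [← hI, C.act_comp _ _ _ _ _ _ (r₁ i).eq.symm]
      simp only [map_sum, C.act_mul]
    have e2 : ∀ i, ∑ j ∈ (r₂ i).index, T X (C.comp (C.act Y X (r.left i) g)
          (C.act X Y ((r₂ i).left j * HopfAlgebra.antipode k ((r₂ i).right j)) f))
        = T X (C.comp (C.act Y X (Coalgebra.counit (R := k) (r.right i) • r.left i) g) f) := by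
      intro i
      simp only [← map_sum, ← LinearMap.sum_apply]
      rw [HopfAlgebra.sum_mul_antipode_eq_smul (r₂ i)]
      simp [C.act_one]
    rw [e1, key, Finset.sum_congr rfl fun i _ => e2 i]
    simp only [← map_sum, ← LinearMap.sum_apply]
    rw [sum_counit_smul_left h r]
  · intro hS X h f
    have h1 := hS X X h (C.id X) f
    rw [C.comp_id, C.act_id, map_smul, map_smul, C.comp_id, smul_eq_mul] at h1
    rw [h1]
    congr 1
    let r := Coalgebra.Repr.arbitrary k h
    rw [twistedAntipode_repr δ h r]
    conv_rhs => rw [← sum_counit_smul_left h r]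
    simp [map_sum, mul_comm]

end HopfCyclicStmt
end
end

section
/- Let (S,∂̂) and (S′,∂̂′) be DG-semicategories, T̂ a closed graded trace of dimension p on S, and T̂′ a closed graded trace of dimension q on S′. Define on the tensor product DG-semicategory S⊗S′ the family of k-linear maps (T̂#T̂′)_{(X,X′)} : Hom^{p+q}_{S⊗S′}((X,X′),(X,X′)) → k by (T̂#T̂′)_{(X,X′)}(f⊗f′) = T̂_X(f_p)·T̂′_{X′}(f′_q) for f⊗f′ = (f_i⊗f′_j)_{i+j=p+q} (i.e., picking out the bidegree (p,q) component). Then T̂#T̂′ is a closed graded trace of dimension p+q on S⊗S′: (T̂#T̂′)_{(X,X′)}(∂̂_{S⊗S′}^{p+q−1}(ω)) = 0 for every ω of degree p+q−1 from (X,X′) to itself, and (T̂#T̂′)_{(X,X′)}(ω′∘ω) = (−1)^{deg(ω)deg(ω′)}(T̂#T̂′)_{(Y,Y′)}(ω∘ω′) for homogeneous ω : (X,X′)→(Y,Y′) and ω′ : (Y,Y′)→(X,X′) of complementary degrees summing to p+q. -/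
open TensorProduct DirectSum

noncomputable section

namespace HopfCyclicStmt

variable (k H : Type) [Field k] [CharZero k] [Ring H] [HopfAlgebra k H]

/-! ### Iterated comultiplication and Sweedler representations -/

/-- `H^{⊗(n+1)}` as iterated binary tensor products, bundled as a module. -/
def TPow : ℕ → ModuleCat.{0} k
  | 0 => ModuleCat.of k H
  | n + 1 => ModuleCat.of k (H ⊗[k] (TPow n))

/-- The pure tensor `c 0 ⊗ c 1 ⊗ ⋯ ⊗ c n` in `H^{⊗(n+1)}`. -/
def chainT : (n : ℕ) → (Fin (n + 1) → H) → TPow k H n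
  | 0, c => (c 0 : H)
  | n + 1, c => show H ⊗[k] (TPow k H n) from (c 0) ⊗ₜ[k] (chainT n fun j => c j.succ)

/-- The iterated comultiplication `Δⁿ : H → H^{⊗(n+1)}`. -/
def comulIter : (n : ℕ) → (H →ₗ[k] TPow k H n)
  | 0 => LinearMap.id
  | n + 1 => show H →ₗ[k] (H ⊗[k] (TPow k H n)) from
      (LinearMap.lTensor H (comulIter n)) ∘ₗ (Coalgebra.comul (R := k))

/-- `∑ᵢ c i 0 ⊗ ⋯ ⊗ c i n` is a finite representation of `Δⁿ h` by pure tensors;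
in Sweedler notation, `c i j` plays the role of `h_{j+1}`. -/
def IsComulRep (n : ℕ) (h : H) {ι : Type} (s : Finset ι) (c : ι → Fin (n + 1) → H) : Prop :=
  comulIter k H n h = ∑ i ∈ s, chainT k H n (c i)

/-! ### group-likes and the twisted antipode -/

variable {k H}

/-! ### DG-semicategories -/

/-- A small `k`-linear semicategory (composition, but no identities required). -/
structure Semicat (k : Type) [Field k] where
  Obj : Type
  Hom : Obj → Obj → Type
  [homAddCommGroup : ∀ X Y, AddCommGroup (Hom X Y)]
  [homModule : ∀ X Y, Module k (Hom X Y)]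
  comp : {X Y Z : Obj} → Hom Y Z →ₗ[k] Hom X Y →ₗ[k] Hom X Z
  comp_assoc : ∀ {W X Y Z : Obj} (h : Hom Y Z) (g : Hom X Y) (f : Hom W X),
      comp h (comp g f) = comp (comp h g) f

attribute [instance] Semicat.homAddCommGroup Semicat.homModule

/-- A non-negatively graded DG-semicategory with objects `Obj`: each `Hom(X,Y)` is a cochain
complex `(Hom n X Y, d)` and composition is a chain map (Leibniz rule). -/
structure DGSemicat (k : Type) [Field k] (Obj : Type) where
  Hom : ℕ → Obj → Obj → Type
  [homAddCommGroup : ∀ n X Y, AddCommGroup (Hom n X Y)]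
  [homModule : ∀ n X Y, Module k (Hom n X Y)]
  comp : {p q : ℕ} → {X Y Z : Obj} → Hom q Y Z →ₗ[k] Hom p X Y →ₗ[k] Hom (q + p) X Z
  comp_assoc : ∀ {p q r : ℕ} {W X Y Z : Obj} (h : Hom r Y Z) (g : Hom q X Y) (f : Hom p W X),
      comp h (comp g f)
        = cast (congrArg (fun t => Hom t W Z) (by omega : r + q + p = r + (q + p)))
            (comp (comp h g) f)
  d : (n : ℕ) → (X Y : Obj) → Hom n X Y →ₗ[k] Hom (n + 1) X Y
  d_sq : ∀ (n : ℕ) (X Y : Obj) (f : Hom n X Y), d (n + 1) X Y (d n X Y f) = 0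
  leibniz : ∀ {p q : ℕ} {X Y Z : Obj} (g : Hom q Y Z) (f : Hom p X Y),
      d (q + p) X Z (comp g f)
        = (cast (congrArg (fun t => Hom t X Z) (by omega : q + 1 + p = q + p + 1))
            (comp (d q Y Z g) f) : Hom (q + p + 1) X Z)
          + ((-1 : k) ^ q) • (show Hom (q + p + 1) X Z from comp g (d p X Y f))

attribute [instance] DGSemicat.homAddCommGroup DGSemicat.homModule

/-- Transport of a graded morphism along equalities of degree and of the two objects. -/
def dgCast {Obj : Type} (S : DGSemicat k Obj) {p q : ℕ} {X X' Y Y' : Obj}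
    (hpq : p = q) (hX : X = X') (hY : Y = Y') (f : S.Hom p X Y) : S.Hom q X' Y' :=
  hpq ▸ hX ▸ hY ▸ f

/-- The degree-`0` part `S⁰` is an ordinary category, i.e. it has identities. -/
def DGSemicat.HasIdents {Obj : Type} (S : DGSemicat k Obj) : Prop :=
  ∃ e : ∀ X : Obj, S.Hom 0 X X,
    (∀ {X Y : Obj} (f : S.Hom 0 X Y), S.comp (e Y) f = f) ∧
    (∀ {X Y : Obj} (f : S.Hom 0 X Y), S.comp f (e X) = f)

/-- A `k`-linear semifunctor from a semicategory `C` to the degree-`0` part of a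
DG-semicategory `S`. -/
structure SemiFun0 (C : Semicat k) {O₂ : Type} (S : DGSemicat k O₂) where
  obj : C.Obj → O₂
  map : ∀ X Y : C.Obj, C.Hom X Y →ₗ[k] S.Hom 0 (obj X) (obj Y)
  map_comp : ∀ {X Y Z : C.Obj} (g : C.Hom Y Z) (f : C.Hom X Y),
      map X Z (C.comp g f) = S.comp (map Y Z g) (map X Y f)

/-- A DG-semifunctor between DG-semicategories. -/
structure DGFun {O₁ O₂ : Type} (S : DGSemicat k O₁) (T : DGSemicat k O₂) where
  obj : O₁ → O₂
  map : ∀ (n : ℕ) (X Y : O₁), S.Hom n X Y →ₗ[k] T.Hom n (obj X) (obj Y)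
  map_comp : ∀ {p q : ℕ} {X Y Z : O₁} (g : S.Hom q Y Z) (f : S.Hom p X Y),
      map (q + p) X Z (S.comp g f) = T.comp (map q Y Z g) (map p X Y f)
  map_d : ∀ (n : ℕ) (X Y : O₁) (f : S.Hom n X Y),
      map (n + 1) X Y (S.d n X Y f) = T.d n (obj X) (obj Y) (map n X Y f)

/-- A closed graded trace of dimension `n` on a DG-semicategory: it vanishes on exact
morphisms and is a graded trace: `T_X(g′∘g) = (−1)^{ij} T_Y(g∘g′)`. -/
def IsClosedGradedTrace {Obj : Type} (S : DGSemicat k Obj) (n : ℕ)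
    (T : ∀ X : Obj, S.Hom n X X →ₗ[k] k) : Prop :=
  (∀ (m : ℕ) (hm : m + 1 = n) (X : Obj) (f : S.Hom m X X),
    T X (dgCast S hm rfl rfl (S.d m X X f)) = 0) ∧
  (∀ (i j : ℕ) (hij : i + j = n) (X Y : Obj) (g : S.Hom i X Y) (g' : S.Hom j Y X),
    T X (dgCast S (by omega) rfl rfl (S.comp g' g))
      = ((-1 : k) ^ (i * j)) * T Y (dgCast S (by omega) rfl rfl (S.comp g g')))

theorem dgCast_add {Obj : Type} (S : DGSemicat k Obj) {p q : ℕ} {X Y : Obj}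
    (h : p = q) (f g : S.Hom p X Y) :
    dgCast S h rfl rfl (f + g) = dgCast S h rfl rfl f + dgCast S h rfl rfl g := by
  subst h; rfl

theorem dgCast_smul {Obj : Type} (S : DGSemicat k Obj) {p q : ℕ} {X Y : Obj}
    (h : p = q) (c : k) (f : S.Hom p X Y) :
    dgCast S h rfl rfl (c • f) = c • dgCast S h rfl rfl f := by
  subst h; rfl

theorem dgCast_zero {Obj : Type} (S : DGSemicat k Obj) {p q : ℕ} {X Y : Obj}
    (h : p = q) : dgCast S h rfl rfl (0 : S.Hom p X Y) = 0 := by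
  subst h; rfl

theorem dgCast_dgCast {Obj : Type} (S : DGSemicat k Obj) {p q r : ℕ} {X Y : Obj}
    (h : p = q) (h' : q = r) (f : S.Hom p X Y) :
    dgCast S h' rfl rfl (dgCast S h rfl rfl f) = dgCast S (h.trans h') rfl rfl f := by
  subst h; subst h'; rfl

/-- **Statement 19.** Let `(S,∂)` and `(S′,∂′)` be DG-semicategories, `T` a closed graded
trace of dimension `p` on `S` and `T′` a closed graded trace of dimension `q` on `S′`.  On the
tensor product DG-semicategory `S ⊗ S′` (presented by its structural inclusions
`incl : Hom^i_S ⊗ Hom^j_{S′} → Hom^{i+j}_{S⊗S′}` with the Koszul-sign composition and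
differential, whose images span), the family `T#T′`, defined by picking out the
bidegree-`(p,q)` component via `(T#T′)(f ⊗ f′) = T(f_p)·T′(f′_q)`, is a closed graded trace
of dimension `p+q`. -/
theorem statement19 {O₁ O₂ : Type} (S : DGSemicat k O₁) (S' : DGSemicat k O₂) (p q : ℕ)
    (T : ∀ X : O₁, S.Hom p X X →ₗ[k] k) (hT : IsClosedGradedTrace S p T)
    (T' : ∀ X' : O₂, S'.Hom q X' X' →ₗ[k] k) (hT' : IsClosedGradedTrace S' q T')
    (TT : DGSemicat k (O₁ × O₂))
    (incl : ∀ (i j : ℕ) (X Y : O₁) (X' Y' : O₂),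
      (S.Hom i X Y ⊗[k] S'.Hom j X' Y') →ₗ[k] TT.Hom (i + j) (X, X') (Y, Y'))
    (hcomp : ∀ {p₁ q₁ p₂ q₂ : ℕ} {X Y Z : O₁} {X' Y' Z' : O₂}
      (g : S.Hom q₁ Y Z) (g' : S'.Hom q₂ Y' Z') (f : S.Hom p₁ X Y) (f' : S'.Hom p₂ X' Y'),
      TT.comp (incl q₁ q₂ Y Z Y' Z' (g ⊗ₜ[k] g')) (incl p₁ p₂ X Y X' Y' (f ⊗ₜ[k] f'))
        = ((-1 : k) ^ (q₂ * p₁)) •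
            dgCast TT (by omega : q₁ + p₁ + (q₂ + p₂) = q₁ + q₂ + (p₁ + p₂)) rfl rfl
              (incl (q₁ + p₁) (q₂ + p₂) X Z X' Z' ((S.comp g f) ⊗ₜ[k] (S'.comp g' f'))))
    (hd : ∀ {i j : ℕ} {X Y : O₁} {X' Y' : O₂} (f : S.Hom i X Y) (f' : S'.Hom j X' Y'),
      TT.d (i + j) (X, X') (Y, Y') (incl i j X Y X' Y' (f ⊗ₜ[k] f'))
        = dgCast TT (by omega : i + 1 + j = i + j + 1) rfl rfl
            (incl (i + 1) j X Y X' Y' ((S.d i X Y f) ⊗ₜ[k] f'))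
          + ((-1 : k) ^ i) • (show TT.Hom (i + j + 1) (X, X') (Y, Y') from
              incl i (j + 1) X Y X' Y' (f ⊗ₜ[k] (S'.d j X' Y' f'))))
    (hspan : ∀ (n : ℕ) (X Y : O₁) (X' Y' : O₂) (w : TT.Hom n (X, X') (Y, Y')),
      w ∈ Submodule.span k {w' : TT.Hom n (X, X') (Y, Y') |
        ∃ (i j : ℕ) (hij : i + j = n) (f : S.Hom i X Y) (f' : S'.Hom j X' Y'),
          w' = dgCast TT hij rfl rfl (incl i j X Y X' Y' (f ⊗ₜ[k] f'))})
    (TTtr : ∀ Z : O₁ × O₂, TT.Hom (p + q) Z Z →ₗ[k] k)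
    (hTTtr : ∀ (i j : ℕ) (hij : i + j = p + q) (X : O₁) (X' : O₂)
      (f : S.Hom i X X) (f' : S'.Hom j X' X'),
      TTtr (X, X') (dgCast TT hij rfl rfl (incl i j X X X' X' (f ⊗ₜ[k] f')))
        = if h : i = p ∧ j = q then T X (dgCast S h.1 rfl rfl f) * T' X' (dgCast S' h.2 rfl rfl f') else 0) :
    IsClosedGradedTrace TT (p + q) TTtr := by
  refine ⟨?_, ?_⟩
  · rintro m hm ⟨X, X'⟩ w
    refine Submodule.span_induction (p := fun w _ =>
      TTtr (X, X') (dgCast TT hm rfl rfl (TT.d m (X, X') (X, X') w)) = 0) ?_ ?_ ?_ ?_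
      (hspan m X X X' X' w)
    · rintro _ ⟨i, j, hij, f, f', rfl⟩
      subst hij
      change TTtr (X, X') (dgCast TT hm rfl rfl
        (TT.d (i + j) (X, X') (X, X') (incl i j X X X' X' (f ⊗ₜ[k] f')))) = 0
      have e2 := hTTtr i (j + 1) (by omega) X X' f (S'.d j X' X' f')
      rw [hd, dgCast_add, dgCast_smul, dgCast_dgCast, map_add, map_smul,
        hTTtr (i + 1) j (by omega)]
      refine (congrArg₂ (· + ·) rfl (congrArg _ e2)).trans ?_
      have z1 : (if h : i + 1 = p ∧ j = q then T X (dgCast S h.1 rfl rfl (S.d i X X f)) *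
          T' X' (dgCast S' h.2 rfl rfl f') else 0) = 0 := by
        split_ifs with h
        · rw [hT.1 i h.1, zero_mul]
        · rfl
      have z2 : (if h : i = p ∧ j + 1 = q then T X (dgCast S h.1 rfl rfl f) *
          T' X' (dgCast S' h.2 rfl rfl (S'.d j X' X' f')) else 0) = 0 := by
        split_ifs with h
        · rw [hT'.1 j h.2, mul_zero]
        · rfl
      simp only [z1, z2, smul_zero, add_zero]
    · rw [map_zero, dgCast_zero, map_zero]
    · intro x y _ _ hx hy
      rw [map_add, dgCast_add, map_add, hx, hy, add_zero]
    · intro c x _ hx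
      rw [map_smul, dgCast_smul, map_smul, hx, smul_zero]
  · rintro i j hij ⟨X, X'⟩ ⟨Y, Y'⟩ w w'
    refine Submodule.span_induction (p := fun w _ =>
      TTtr (X, X') (dgCast TT (by omega) rfl rfl (TT.comp w' w))
      = ((-1 : k) ^ (i * j)) * TTtr (Y, Y') (dgCast TT (by omega) rfl rfl (TT.comp w w')))
      ?_ ?_ ?_ ?_ (hspan i X Y X' Y' w)
    · rintro _ ⟨a, b, hab, f, f', rfl⟩
      refine Submodule.span_induction (p := fun w' _ =>
        TTtr (X, X') (dgCast TT (by omega) rfl rfl (TT.comp w'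
          (dgCast TT hab rfl rfl (incl a b X Y X' Y' (f ⊗ₜ[k] f')))))
        = ((-1 : k) ^ (i * j)) * TTtr (Y, Y') (dgCast TT (by omega) rfl rfl (TT.comp
          (dgCast TT hab rfl rfl (incl a b X Y X' Y' (f ⊗ₜ[k] f'))) w')))
        ?_ ?_ ?_ ?_ (hspan j Y X Y' X' w')
      · rintro _ ⟨c, d, hcd, g, g', rfl⟩
        subst hab
        subst hcd
        change TTtr (X, X') (dgCast TT (by omega) rfl rfl (TT.comp
          (incl c d Y X Y' X' (g ⊗ₜ[k] g')) (incl a b X Y X' Y' (f ⊗ₜ[k] f'))))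
          = ((-1 : k) ^ ((a + b) * (c + d))) * TTtr (Y, Y') (dgCast TT (by omega) rfl rfl
            (TT.comp (incl a b X Y X' Y' (f ⊗ₜ[k] f')) (incl c d Y X Y' X' (g ⊗ₜ[k] g'))))
        rw [hcomp, hcomp, dgCast_smul, dgCast_smul, dgCast_dgCast, dgCast_dgCast, map_smul,
          map_smul, hTTtr (c + a) (d + b) (by omega), hTTtr (a + c) (b + d) (by omega)]
        by_cases h : a + c = p ∧ b + d = q
        · rw [dif_pos (by omega), dif_pos h, hT.2 a c h.1, hT'.2 b d h.2]
          simp only [smul_eq_mul]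
          have e : ((-1 : k) ^ ((a + b) * (c + d))) * (-1) ^ (b * c)
              = (-1) ^ (d * a) * (-1) ^ (a * c) * (-1) ^ (b * d) := by
            have e0 : ((-1 : k) ^ (b * c)) * (-1) ^ (b * c) = 1 := by
              rw [← mul_pow]; simp
            have e1 : (a + b) * (c + d) = d * a + a * c + b * d + b * c := by ring
            rw [e1, pow_add, mul_assoc, e0, mul_one, pow_add, pow_add]
          rw [← mul_assoc _ ((-1 : k) ^ (b * c)), e]
          ring
        · rw [dif_neg (by omega), dif_neg h]
          simp
      · simp only [map_zero, LinearMap.zero_apply, dgCast_zero, mul_zero]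
      · intro x y _ _ hx hy
        simp only [map_add, LinearMap.add_apply, dgCast_add, mul_add, hx, hy]
      · intro c x _ hx
        simp only [map_smul, LinearMap.smul_apply, dgCast_smul, hx, smul_eq_mul]
        ring
    · simp only [map_zero, LinearMap.zero_apply, dgCast_zero, mul_zero]
    · intro x y _ _ hx hy
      simp only [map_add, LinearMap.add_apply, dgCast_add, mul_add, hx, hy]
    · intro c x _ hx
      simp only [map_smul, LinearMap.smul_apply, dgCast_smul, hx, smul_eq_mul]
      ring


end HopfCyclicStmt
end
end
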